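/- Let the dataset contain at least K distinct points and the communication graph be connected. Let (x̆^ρ)_{ρ∈ℕ} be any sequence such that x̆^ρ ∈ M̄^ρ for each ρ ∈ ℕ. Then for each agent m = 1,…,M, the distance from x̆_m^ρ = (x̆_m^{ρ,1},…,x̆_m^{ρ,K}) to the set Z̄ of Lloyd's minima with centers in the closed convex hull of D tends to 0 as ρ → ∞. -/

import Mathlib

open scoped BigOperators

noncomputable section

/-! ### Basic (centralized) K-means notions -/

/-- The dataset `D` contains at least `K` distinct points. -/
def HasKDistinct {p : ℕ} (K : ℕ) (D : Multiset (EuclideanSpace ℝ (Fin p))) : Prop :=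
  ∃ S : Finset (EuclideanSpace ℝ (Fin p)), S.card = K ∧ ∀ y ∈ S, y ∈ D

/-- The K-means clustering cost `F(x) = ∑_{y ∈ D} min_k ‖y - x^k‖²`. -/
def kmeansF {p : ℕ} (K : ℕ) (D : Multiset (EuclideanSpace ℝ (Fin p)))
    (x : Fin K → EuclideanSpace ℝ (Fin p)) : ℝ :=
  (D.map fun y => ⨅ k : Fin K, ‖y - x k‖ ^ 2).sum

/-- `P` is a partition of the multiset `D` into `K` (possibly empty) cells. -/
def IsKPartition {p K : ℕ} (D : Multiset (EuclideanSpace ℝ (Fin p)))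
    (P : Fin K → Multiset (EuclideanSpace ℝ (Fin p))) : Prop :=
  ∑ k, P k = D

/-- The distortion cost `H(x, P) = ∑_k ∑_{y ∈ P^k} ‖y - x^k‖²`. -/
def costH {p K : ℕ} (x : Fin K → EuclideanSpace ℝ (Fin p))
    (P : Fin K → Multiset (EuclideanSpace ℝ (Fin p))) : ℝ :=
  ∑ k, ((P k).map fun y => ‖y - x k‖ ^ 2).sum

/-- `(x, P)` is a Lloyd's minimum for the dataset `D`. -/
def IsLloydMin {p K : ℕ} (D : Multiset (EuclideanSpace ℝ (Fin p)))
    (x : Fin K → EuclideanSpace ℝ (Fin p))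
    (P : Fin K → Multiset (EuclideanSpace ℝ (Fin p))) : Prop :=
  IsKPartition D P ∧
    (∀ Q, IsKPartition D Q → costH x P ≤ costH x Q) ∧
    (∀ x', costH x P ≤ costH x' P)

/-- The set `Z` of Lloyd's minima (cluster-center tuples). -/
def LloydZ {p : ℕ} (K : ℕ) (D : Multiset (EuclideanSpace ℝ (Fin p))) :
    Set (Fin K → EuclideanSpace ℝ (Fin p)) :=
  {x | ∃ P, IsLloydMin D x P}

/-- The set `Z̄` of Lloyd's minima whose centers lie in the (closed) convex hull of `D`. -/
def LloydZbar {p : ℕ} (K : ℕ) (D : Multiset (EuclideanSpace ℝ (Fin p))) :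
    Set (Fin K → EuclideanSpace ℝ (Fin p)) :=
  {x ∈ LloydZ K D | ∀ k, x k ∈ convexHull ℝ {y | y ∈ D}}

/-- The set `Z_g` of global minimizers of the K-means cost `F`. -/
def kmeansZg {p : ℕ} (K : ℕ) (D : Multiset (EuclideanSpace ℝ (Fin p))) :
    Set (Fin K → EuclideanSpace ℝ (Fin p)) :=
  {x | ∀ x', kmeansF K D x ≤ kmeansF K D x'}

/-- The global minimum value `F*` of the K-means cost. -/
def Fstar {p : ℕ} (K : ℕ) (D : Multiset (EuclideanSpace ℝ (Fin p))) : ℝ :=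
  sInf (Set.range (kmeansF K D))

/-- `R₀ = max{‖v‖ : v ∈ closed convex hull of D}`. -/
def R0 {p : ℕ} (D : Multiset (EuclideanSpace ℝ (Fin p))) : ℝ :=
  sSup ((fun v => ‖v‖) '' convexHull ℝ {y | y ∈ D})

/-! ### Multi-agent notions -/

section Distributed

variable {p K M : ℕ}

/-- The multi-agent cost `J^ρ(x, C)`; each undirected edge is counted once in the
agreement term. -/
def costJ (ρ : ℝ) (G : SimpleGraph (Fin M)) [DecidableRel G.Adj]
    (x : Fin M → Fin K → EuclideanSpace ℝ (Fin p))
    (C : Fin M → Fin K → Multiset (EuclideanSpace ℝ (Fin p))) : ℝ :=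
  (1 / ρ) * ∑ m, ∑ k, ((C m k).map fun y => ‖y - x m k‖ ^ 2).sum +
    (1 / 2) * ∑ m, ∑ l ∈ G.neighborFinset m, ∑ k, ‖x m k - x l k‖ ^ 2

/-- The multi-agent cost `Q^ρ(x)`. -/
def costQ (ρ : ℝ) (G : SimpleGraph (Fin M)) [DecidableRel G.Adj]
    (Dm : Fin M → Multiset (EuclideanSpace ℝ (Fin p)))
    (x : Fin M → Fin K → EuclideanSpace ℝ (Fin p)) : ℝ :=
  (1 / ρ) * ∑ m, ((Dm m).map fun y => ⨅ k : Fin K, ‖y - x m k‖ ^ 2).sum +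
    (1 / 2) * ∑ m, ∑ l ∈ G.neighborFinset m, ∑ k, ‖x m k - x l k‖ ^ 2

/-- The set of global minimizers `M^ρ_g` of `Q^ρ`. -/
def globQ (ρ : ℝ) (G : SimpleGraph (Fin M)) [DecidableRel G.Adj]
    (Dm : Fin M → Multiset (EuclideanSpace ℝ (Fin p))) (K : ℕ) :
    Set (Fin M → Fin K → EuclideanSpace ℝ (Fin p)) :=
  {x | ∀ x' : Fin M → Fin K → EuclideanSpace ℝ (Fin p), costQ ρ G Dm x ≤ costQ ρ G Dm x'}

/-- `C ∈ U_x` : `C` is an admissible (Voronoi / nearest-center) clustering for `x`. -/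
def InVoronoi (Dm : Fin M → Multiset (EuclideanSpace ℝ (Fin p)))
    (x : Fin M → Fin K → EuclideanSpace ℝ (Fin p))
    (C : Fin M → Fin K → Multiset (EuclideanSpace ℝ (Fin p))) : Prop :=
  (∀ m, IsKPartition (Dm m) (C m)) ∧
    ∀ m k y, y ∈ C m k → ∀ k', ‖y - x m k‖ ≤ ‖y - x m k'‖

/-- The fixed-point (stationarity) equations
`((1/ρ)|C_m^k| + |Ω_m|) x_m^k = (1/ρ) ∑_{y ∈ C_m^k} y + ∑_{l ∈ Ω_m} x_l^k`. -/
def IsFixedCenters (ρ : ℝ) (G : SimpleGraph (Fin M)) [DecidableRel G.Adj]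
    (x : Fin M → Fin K → EuclideanSpace ℝ (Fin p))
    (C : Fin M → Fin K → Multiset (EuclideanSpace ℝ (Fin p))) : Prop :=
  ∀ m k, ((1 / ρ) * ((C m k).card : ℝ) + (G.degree m : ℝ)) • x m k =
      (1 / ρ) • (C m k).sum + ∑ l ∈ G.neighborFinset m, x l k

/-- `(x, C)` is a generalized Lloyd's minimum of `J^ρ`. -/
def IsGenLloydMin (ρ : ℝ) (G : SimpleGraph (Fin M)) [DecidableRel G.Adj]
    (Dm : Fin M → Multiset (EuclideanSpace ℝ (Fin p)))
    (x : Fin M → Fin K → EuclideanSpace ℝ (Fin p))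
    (C : Fin M → Fin K → Multiset (EuclideanSpace ℝ (Fin p))) : Prop :=
  InVoronoi Dm x C ∧ IsFixedCenters ρ G x C

/-- The set `M^ρ` of generalized Lloyd's minima (centers part). -/
def genM (ρ : ℝ) (G : SimpleGraph (Fin M)) [DecidableRel G.Adj]
    (Dm : Fin M → Multiset (EuclideanSpace ℝ (Fin p))) (K : ℕ) :
    Set (Fin M → Fin K → EuclideanSpace ℝ (Fin p)) :=
  {x | ∃ C, IsGenLloydMin ρ G Dm x C}

/-- The set `M̄^ρ` of generalized Lloyd's minima with all centers in the (closed)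
convex hull of the collective dataset `D`. -/
def genMbar (ρ : ℝ) (G : SimpleGraph (Fin M)) [DecidableRel G.Adj]
    (Dm : Fin M → Multiset (EuclideanSpace ℝ (Fin p)))
    (D : Multiset (EuclideanSpace ℝ (Fin p))) (K : ℕ) :
    Set (Fin M → Fin K → EuclideanSpace ℝ (Fin p)) :=
  {x ∈ genM ρ G Dm K | ∀ m k, x m k ∈ convexHull ℝ {y | y ∈ D}}

/-- The update target
`μ_m^k = ((1/ρ) ∑_{y ∈ C_m^k} y + ∑_{l ∈ Ω_m} x_l^k) / ((1/ρ)|C_m^k| + |Ω_m|)`. -/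
def muVec (ρ : ℝ) (G : SimpleGraph (Fin M)) [DecidableRel G.Adj]
    (x : Fin M → Fin K → EuclideanSpace ℝ (Fin p))
    (C : Fin M → Fin K → Multiset (EuclideanSpace ℝ (Fin p)))
    (m : Fin M) (k : Fin K) : EuclideanSpace ℝ (Fin p) :=
  ((1 / ρ) * ((C m k).card : ℝ) + (G.degree m : ℝ))⁻¹ •
    ((1 / ρ) • (C m k).sum + ∑ l ∈ G.neighborFinset m, x l k)

/-- `(x_t, C_t)` is a trajectory of the NK-means algorithm with parameters `ρ, α`. -/
def NKMeansSeq (ρ α : ℝ) (G : SimpleGraph (Fin M)) [DecidableRel G.Adj]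
    (Dm : Fin M → Multiset (EuclideanSpace ℝ (Fin p)))
    (x : ℕ → Fin M → Fin K → EuclideanSpace ℝ (Fin p))
    (C : ℕ → Fin M → Fin K → Multiset (EuclideanSpace ℝ (Fin p))) : Prop :=
  (∀ m, IsKPartition (Dm m) (C 0 m)) ∧
    ∀ t, (∀ m, IsKPartition (Dm m) (C (t + 1) m)) ∧
      (∀ m k y, y ∈ C (t + 1) m k → ∀ k', ‖y - x t m k‖ ≤ ‖y - x t m k'‖) ∧
      ∀ m k, x (t + 1) m k = x t m k - α • (x t m k - muVec ρ G (x t) (C (t + 1)) m k)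

/-- The minimum vertex degree `d_min` of the communication graph. -/
def minDeg (G : SimpleGraph (Fin M)) [DecidableRel G.Adj] : ℕ :=
  sInf (Set.range fun m : Fin M => G.degree m)

/-- The largest eigenvalue `λ_M(L)` of the graph Laplacian. -/
def lapLamMax (G : SimpleGraph (Fin M)) [DecidableRel G.Adj] : ℝ :=
  sSup (spectrum ℝ (G.lapMatrix ℝ))

/-- The second-smallest eigenvalue `λ₂(L)` of the graph Laplacian (for a connected
graph, the smallest nonzero eigenvalue). -/
def lapLam2 (G : SimpleGraph (Fin M)) [DecidableRel G.Adj] : ℝ :=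
  sInf {μ : ℝ | μ ∈ spectrum ℝ (G.lapMatrix ℝ) ∧ μ ≠ 0}

/-- `N* = max_m |D_m|`. -/
def Nstar (Dm : Fin M → Multiset (EuclideanSpace ℝ (Fin p))) : ℕ :=
  Finset.univ.sup fun m => (Dm m).card

/-- The step-size condition `0 < α < d_min / ((1/ρ) N* + λ_M(L))`. -/
def StepOK (ρ α : ℝ) (G : SimpleGraph (Fin M)) [DecidableRel G.Adj]
    (Dm : Fin M → Multiset (EuclideanSpace ℝ (Fin p))) : Prop :=
  0 < α ∧ α * ((1 / ρ) * (Nstar Dm : ℝ) + lapLamMax G) < (minDeg G : ℝ)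

/-- The constant `c(α) = 2α(d_min − α((1/ρ)N* + λ_M(L)))`. -/
def cAlpha (ρ α : ℝ) (G : SimpleGraph (Fin M)) [DecidableRel G.Adj]
    (Dm : Fin M → Multiset (EuclideanSpace ℝ (Fin p))) : ℝ :=
  2 * α * ((minDeg G : ℝ) - α * ((1 / ρ) * (Nstar Dm : ℝ) + lapLamMax G))

end Distributed
section Helpers

open Filter Topology

variable {p K M : ℕ}

local notation "E" => EuclideanSpace ℝ (Fin p)

lemma kmeansF_sum (x : Fin K → E) (Q : Fin K → Multiset E) :
    kmeansF K (∑ k, Q k) x = ∑ k, kmeansF K (Q k) x :=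
  map_sum (Multiset.sumAddMonoidHom.comp
    (Multiset.mapAddMonoidHom fun y : E => ⨅ k : Fin K, ‖y - x k‖ ^ 2)) Q Finset.univ

lemma kmeansF_le_costH {D : Multiset E} {x : Fin K → E} {Q : Fin K → Multiset E}
    (hQ : IsKPartition D Q) : kmeansF K D x ≤ costH x Q := by
  rw [← hQ, kmeansF_sum]
  exact Finset.sum_le_sum fun k _ => Multiset.sum_map_le_sum_map _ _ fun y _ =>
    ciInf_le (Set.finite_range _).bddBelow k

lemma costH_eq_kmeansF {D : Multiset E} {x : Fin K → E} {P : Fin K → Multiset E}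
    (hP : IsKPartition D P) (hV : ∀ k, ∀ y ∈ P k, ∀ k', ‖y - x k‖ ≤ ‖y - x k'‖) :
    costH x P = kmeansF K D x := by
  refine le_antisymm ?_ (kmeansF_le_costH hP)
  rw [← hP, kmeansF_sum]
  refine Finset.sum_le_sum fun k _ => Multiset.sum_map_le_sum_map _ _ fun y hy => ?_
  have : Nonempty (Fin K) := ⟨k⟩
  exact le_ciInf fun k' => by gcongr; exact hV k y hy k'

lemma sum_sq_dist_eq (P : Multiset E) (x x' : E) :
    (P.map fun y => ‖y - x'‖ ^ 2).sum = (P.map fun y => ‖y - x‖ ^ 2).sum +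
      2 * inner ℝ (P.sum - (P.card : ℝ) • x) (x - x') + P.card * ‖x - x'‖ ^ 2 := by
  induction P using Multiset.induction_on with
  | empty => simp
  | cons a P ih =>
    have h : ‖a - x'‖ ^ 2 = ‖a - x‖ ^ 2 + 2 * inner ℝ (a - x) (x - x') + ‖x - x'‖ ^ 2 := by
      rw [← norm_add_sq_real, sub_add_sub_cancel]
    have hsum : (a ::ₘ P).sum - ((a ::ₘ P).card : ℝ) • x =
        (P.sum - (P.card : ℝ) • x) + (a - x) := by
      rw [Multiset.sum_cons, Multiset.card_cons]
      push_cast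
      module
    rw [hsum, inner_add_left, Multiset.map_cons, Multiset.sum_cons, Multiset.map_cons,
      Multiset.sum_cons, Multiset.card_cons, ih, h]
    push_cast
    ring

/-- Nearest-center cells together with centroid centers form a Lloyd's minimum. -/
lemma isLloydMin_of_voronoi_of_centroid {D : Multiset E} {x : Fin K → E}
    {P : Fin K → Multiset E} (hP : IsKPartition D P)
    (hV : ∀ k, ∀ y ∈ P k, ∀ k', ‖y - x k‖ ≤ ‖y - x k'‖)
    (hc : ∀ k, (P k).sum = ((P k).card : ℝ) • x k) : IsLloydMin D x P := by
  refine ⟨hP, fun Q hQ => costH_eq_kmeansF hP hV ▸ kmeansF_le_costH hQ, fun x' => ?_⟩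
  refine Finset.sum_le_sum fun k _ => ?_
  rw [sum_sq_dist_eq (P k) (x k) (x' k), hc k, sub_self, inner_zero_left]
  have : 0 ≤ ((P k).card : ℝ) * ‖x k - x' k‖ ^ 2 := by positivity
  linarith

lemma finite_setOf_isKPartition (D : Multiset E) :
    {P : Fin K → Multiset E | IsKPartition D P}.Finite := by
  refine (Set.Finite.pi' fun _ : Fin K => Set.finite_Iic D).subset fun P hP k => ?_
  rw [Set.mem_Iic, ← show ∑ k, P k = D from hP]
  exact Finset.single_le_sum (fun _ _ => zero_le) (Finset.mem_univ k)

lemma sum_sum_neighborFinset (G : SimpleGraph (Fin M)) [DecidableRel G.Adj] (f : Fin M → E) :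
    ∑ m, ∑ l ∈ G.neighborFinset m, f l = ∑ m, (G.degree m : ℝ) • f m := by
  rw [Finset.sum_comm' (t' := Finset.univ) (s' := fun l => G.neighborFinset l)
    (by simp [G.adj_comm])]
  simp [Nat.cast_smul_eq_nsmul]

lemma sum_centroid_eq_of_isFixedCenters {ρ : ℝ} (hρ : ρ ≠ 0) {G : SimpleGraph (Fin M)}
    [DecidableRel G.Adj] {x : Fin M → Fin K → E} {C : Fin M → Fin K → Multiset E}
    (h : IsFixedCenters ρ G x C) (k : Fin K) :
    ∑ m, (C m k).sum = ∑ m, ((C m k).card : ℝ) • x m k := by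
  have hs := Finset.sum_congr rfl fun m (_ : m ∈ Finset.univ) => h m k
  simp only [add_smul, Finset.sum_add_distrib, sum_sum_neighborFinset, add_left_inj, mul_smul,
    ← Finset.smul_sum] at hs
  exact (smul_right_injective _ (one_div_ne_zero hρ) hs).symm

/-- A function on a connected graph with vanishing Laplacian is constant. -/
lemma eq_of_degree_smul_eq_sum_neighborFinset {G : SimpleGraph (Fin M)} [DecidableRel G.Adj]
    (hG : G.Connected) {f : Fin M → E}
    (h : ∀ m, (G.degree m : ℝ) • f m = ∑ l ∈ G.neighborFinset m, f l) (m l : Fin M) :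
    f m = f l := by
  ext i
  refine (G.lapMatrix_mulVec_eq_zero_iff_forall_reachable (x := fun j => f j i)).1 ?_ m l
    (hG.preconnected m l)
  ext j
  rw [G.lapMatrix_mulVec_apply]
  simpa [sub_eq_zero] using congrArg (fun v : E => v i) (h j)

/-- A limit of generalized Lloyd's minima with a common clustering, as `ρ → ∞`, is a consensual
Lloyd's minimum. -/
lemma mem_LloydZ_of_tendsto {Dm : Fin M → Multiset E} {G : SimpleGraph (Fin M)}
    [DecidableRel G.Adj] (hG : G.Connected) {ρ : ℕ → ℝ} (hρ0 : ∀ n, ρ n ≠ 0)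
    (hρ : Tendsto ρ atTop atTop) {x : ℕ → Fin M → Fin K → E} {C : Fin M → Fin K → Multiset E}
    (hx : ∀ n, IsGenLloydMin (ρ n) G Dm (x n) C) {a : Fin M → Fin K → E}
    (ha : Tendsto x atTop (𝓝 a)) (m : Fin M) : a m ∈ LloydZ K (∑ m, Dm m) := by
  have hat : ∀ m k, Tendsto (fun n => x n m k) atTop (𝓝 (a m k)) := fun m k =>
    tendsto_pi_nhds.1 (tendsto_pi_nhds.1 ha m) k
  have hinv : Tendsto (fun n => 1 / ρ n) atTop (𝓝 0) := by
    simp only [one_div]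
    exact hρ.inv_tendsto_atTop
  have hcons : ∀ m l k, a m k = a l k := fun m l k => by
    refine eq_of_degree_smul_eq_sum_neighborFinset hG (f := fun m => a m k) (fun m => ?_) m l
    have h₁ := ((hinv.mul_const ((C m k).card : ℝ)).add_const (G.degree m : ℝ)).smul (hat m k)
    have h₂ := (hinv.smul_const (C m k).sum).add
      (tendsto_finsetSum (G.neighborFinset m) fun l _ => hat l k)
    have h := tendsto_nhds_unique (h₁.congr fun n => (hx n).2 m k) h₂
    simpa using h
  refine ⟨fun k => ∑ j, C j k, isLloydMin_of_voronoi_of_centroid ?_ ?_ ?_⟩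
  · rw [IsKPartition, Finset.sum_comm]
    exact Finset.sum_congr rfl fun j _ => (hx 0).1.1 j
  · intro k y hy k'
    obtain ⟨j, -, hj⟩ := Multiset.mem_sum.1 hy
    rw [hcons m j k, hcons m j k']
    exact le_of_tendsto_of_tendsto' ((hat j k).const_sub y).norm ((hat j k').const_sub y).norm
      fun n => (hx n).1.2 j k y hj k'
  · intro k
    have h := tendsto_nhds_unique
      (tendsto_const_nhds.congr fun n => sum_centroid_eq_of_isFixedCenters (hρ0 n) (hx n).2 k)
      (tendsto_finsetSum Finset.univ fun j _ => (hat j k).const_smul ((C j k).card : ℝ))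
    have hsum : (∑ j, C j k).sum = ∑ j, (C j k).sum :=
      map_sum Multiset.sumAddMonoidHom _ _
    rw [hsum, h, Multiset.card_sum, Nat.cast_sum, Finset.sum_smul]
    exact Finset.sum_congr rfl fun j _ => by rw [hcons j m k]

end Helpers

/-- Theorem 1: if `x̆^ρ ∈ M̄^ρ` for each `ρ ∈ ℕ₊`, then for each agent
`m`, `d(x̆_m^ρ, Z̄) → 0` as `ρ → ∞`. -/
theorem stmt2 {p K M : ℕ} (hK2 : 2 ≤ K)
    (Dm : Fin M → Multiset (EuclideanSpace ℝ (Fin p)))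
    (D : Multiset (EuclideanSpace ℝ (Fin p))) (hD : ∑ m, Dm m = D)
    (hdistinct : HasKDistinct K D)
    (G : SimpleGraph (Fin M)) [DecidableRel G.Adj] (hconn : G.Connected)
    (xs : ℕ → Fin M → Fin K → EuclideanSpace ℝ (Fin p))
    (hxs : ∀ n : ℕ, xs n ∈ genMbar ((n : ℝ) + 1) G Dm D K) :
    ∀ m, Filter.Tendsto (fun n => Metric.infDist (xs n m) (LloydZbar K D))
      Filter.atTop (nhds 0) := by
  intro m
  subst hD
  choose C hC using fun n => (hxs n).1
  refine Filter.tendsto_of_subseq_tendsto fun ns hns => ?_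
  have hfin : {P : Fin M → Fin K → Multiset (EuclideanSpace ℝ (Fin p)) |
      ∀ j, IsKPartition (Dm j) (P j)}.Finite :=
    Set.Finite.pi' fun j => finite_setOf_isKPartition (Dm j)
  obtain ⟨C₀, -, hC₀⟩ := (Filter.frequently_exists_finite hfin (l := Filter.atTop)
    (p := fun c n => C (ns n) = c)).1
      (Filter.Frequently.of_forall fun n => ⟨_, (hC (ns n)).1.1, rfl⟩)
  obtain ⟨φ, hφ, hCφ⟩ := Filter.extraction_of_frequently_atTop hC₀
  set S := convexHull ℝ {y | y ∈ ∑ j, Dm j}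
  have hS : IsCompact S := by
    classical
    refine Set.Finite.isCompact_convexHull ℝ ?_
    exact (∑ j, Dm j).toFinset.finite_toSet.subset fun y hy => by simpa using hy
  have hT : IsCompact {x : Fin M → Fin K → EuclideanSpace ℝ (Fin p) | ∀ j k, x j k ∈ S} :=
    isCompact_pi_infinite fun _ => isCompact_pi_infinite fun _ => hS
  obtain ⟨a, haS, ψ, hψ, ha⟩ := hT.tendsto_subseq fun n => (hxs (ns (φ n))).2
  have hsub : Filter.Tendsto (fun n => ns (φ (ψ n))) Filter.atTop Filter.atTop :=
    hns.comp (hφ.tendsto_atTop.comp hψ.tendsto_atTop)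
  have hmem : a m ∈ LloydZbar K (∑ j, Dm j) :=
    ⟨mem_LloydZ_of_tendsto hconn (fun n => Nat.cast_add_one_ne_zero (ns (φ (ψ n))))
      (Filter.tendsto_atTop_add_const_right _ 1 (tendsto_natCast_atTop_atTop.comp hsub))
      (fun n => hCφ (ψ n) ▸ hC (ns (φ (ψ n)))) ha m, haS m⟩
  refine ⟨φ ∘ ψ, ?_⟩
  have hdist := ((Metric.continuous_infDist_pt (LloydZbar K (∑ j, Dm j))).tendsto (a m)).comp
    (tendsto_pi_nhds.1 ha m)
  rwa [Metric.infDist_zero_of_mem hmem] at hdist
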